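/- Let τ, t*, T₂ be real numbers with 1 < τ < 2, 2 < t* < 3, 3 < T₂ < 4 satisfying τ = T₂ − 2·cos((τ − 1)/2), t* = (T₂ + 1)/2, and T₂ = t* + 2·cos((2t* + τ)/4 − 3/4) (numerically τ ≈ 1.7815, T₂ ≈ 3.6307). In the priority evacuation model with 2 servants, if trajectories Q, S₁, S₂ evacuate the queen in time B for some real B < T₂, then the arc measure of the set of points of the unit circle visited by the queen (at some time) is at most τ − 1. -/

import Mathlib

open Real Set MeasureTheory
open scoped RealInnerProductSpace

noncomputable section

abbrev Plane : Type := EuclideanSpace ℝ (Fin 2)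

/-- The point of the unit circle at angle `θ`. -/
def circlePt (θ : ℝ) : Plane := (WithLp.equiv 2 (Fin 2 → ℝ)).symm ![Real.cos θ, Real.sin θ]

/-- A trajectory in the priority evacuation model: a `1`-Lipschitz function on `[0, ∞)`
starting at the origin. -/
def IsTraj (f : ℝ → Plane) : Prop :=
  LipschitzOnWith 1 f (Set.Ici 0) ∧ f 0 = 0

/-- The first-visit time of the point `p` by the queen `Q` or one of the servants `S i`. -/
def visitTime {n : ℕ} (Q : ℝ → Plane) (S : Fin n → ℝ → Plane) (p : Plane) : ℝ :=
  sInf {t : ℝ | 0 ≤ t ∧ (Q t = p ∨ ∃ i, S i t = p)}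

/-- The trajectories `Q` (queen) and `S 0, …, S (n-1)` (servants) evacuate the queen in
time `B`: every point of the unit circle is visited, and the first-visit time plus the
distance from the queen (at that moment) to the point is at most `B`. -/
def Evacuates {n : ℕ} (Q : ℝ → Plane) (S : Fin n → ℝ → Plane) (B : ℝ) : Prop :=
  ∀ p : Plane, ‖p‖ = 1 →
    (∃ t : ℝ, 0 ≤ t ∧ (Q t = p ∨ ∃ i, S i t = p)) ∧
    visitTime Q S p + ‖Q (visitTime Q S p) - p‖ ≤ B

/-- The set of angles in `[0, 2π)` whose circle point is visited by the queen at some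
time in `Tset`; its Lebesgue measure is the arc measure of the queen-explored set. -/
def queenArc (Q : ℝ → Plane) (Tset : Set ℝ) : Set ℝ :=
  {θ : ℝ | θ ∈ Set.Ico 0 (2 * π) ∧ ∃ s ∈ Tset, Q s = circlePt θ}

lemma norm_circlePt_sub (a b : ℝ) :
    ‖circlePt a - circlePt b‖ = 2 * |Real.sin ((a - b) / 2)| := by
  have h : ‖circlePt a - circlePt b‖ ^ 2 = (2 * |Real.sin ((a - b) / 2)|) ^ 2 := by
    rw [EuclideanSpace.norm_sq_eq, mul_pow, sq_abs, Real.sin_sq_eq_half_sub]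
    simp only [circlePt, Fin.sum_univ_two, Real.norm_eq_abs, sq_abs]
    simp
    rw [show 2 * ((a - b) / 2) = a - b by ring, Real.cos_sub]
    nlinarith [Real.sin_sq_add_cos_sq a, Real.sin_sq_add_cos_sq b]
  exact (pow_left_inj₀ (norm_nonneg _) (by positivity) two_ne_zero).1 h

lemma norm_circlePt (θ : ℝ) : ‖circlePt θ‖ = 1 := by
  simp [circlePt, EuclideanSpace.norm_eq, Fin.sum_univ_two]

lemma exists_circlePt_eq {p : Plane} (hp : ‖p‖ = 1) : ∃ θ, circlePt θ = p := by
  have hz : ‖(⟨p 0, p 1⟩ : ℂ)‖ = 1 := by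
    rw [EuclideanSpace.norm_eq, Fin.sum_univ_two] at hp
    simp only [Real.norm_eq_abs, sq_abs] at hp
    rw [Complex.norm_def, Complex.normSq_mk, ← hp]
    ring_nf
  have h0 : (⟨p 0, p 1⟩ : ℂ) ≠ 0 := by
    intro h; simp [h] at hz
  refine ⟨Complex.arg ⟨p 0, p 1⟩, ?_⟩
  ext i
  fin_cases i
  · simp [circlePt, Complex.cos_arg h0, hz]
  · simp [circlePt, Complex.sin_arg, hz]

lemma continuous_circlePt : Continuous circlePt := by
  have : LipschitzWith 1 circlePt := by
    refine LipschitzWith.of_dist_le_mul fun a b => ?_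
    rw [dist_eq_norm, norm_circlePt_sub, Real.dist_eq, NNReal.coe_one, one_mul]
    have := Real.abs_sin_le_abs (x := (a - b) / 2)
    rw [abs_div, abs_two] at this
    linarith
  exact this.continuous

lemma circlePt_add_int_mul (θ : ℝ) (n : ℤ) : circlePt (θ + n * (2 * π)) = circlePt θ := by
  simp [circlePt, Real.cos_add_int_mul_two_pi, Real.sin_add_int_mul_two_pi]

/-- The arc measure of a set of points may be computed on any interval of length `2π`. -/
lemma volume_circlePt_preimage_inter_Ioc {A : Set Plane} (hA : MeasurableSet A) (a b : ℝ) :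
    volume (circlePt ⁻¹' A ∩ Ioc a (a + 2 * π)) = volume (circlePt ⁻¹' A ∩ Ioc b (b + 2 * π)) := by
  refine (isAddFundamentalDomain_Ioc Real.two_pi_pos a volume).measure_set_eq
    (isAddFundamentalDomain_Ioc Real.two_pi_pos b volume)
    (continuous_circlePt.measurable hA) ?_
  rintro ⟨g, hg⟩
  obtain ⟨n, rfl⟩ := AddSubgroup.mem_zmultiples_iff.1 hg
  ext x
  simp only [mem_preimage, AddSubgroup.mk_vadd, vadd_eq_add, zsmul_eq_mul]
  rw [add_comm, circlePt_add_int_mul]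

lemma abs_le_add_cube {r h : ℝ} (hr : |r| ≤ π)
    (hs : 2 * |Real.sin (r / 2)| ≤ h) : |r| ≤ h + h ^ 3 := by
  set x := |r| with hx
  have hx0 : 0 ≤ x := abs_nonneg r
  have e : |Real.sin (r / 2)| = Real.sin (x / 2) := by
    rw [Real.abs_sin_eq_sin_abs_of_abs_le_pi]
    · rw [abs_div, abs_two]
    · rw [abs_div, abs_two]; linarith
  rw [e] at hs
  have hj := Real.mul_le_sin (x := x / 2) (by linarith) (by linarith)
  have h1 : 2 / π * (x / 2) = x / π := by ring
  rw [h1] at hj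
  have h2 : x ≤ π / 2 * h := by
    have : x / π ≤ h / 2 := by linarith
    rw [div_le_iff₀ Real.pi_pos] at this
    linarith
  have hπ := Real.pi_lt_d2
  have hh0 : 0 ≤ h := by
    have : 0 ≤ x / π := by positivity
    linarith
  have h3 : x ≤ 1.6 * h := by nlinarith
  have h5 : x ^ 3 ≤ (1.6 * h) ^ 3 := by gcongr
  have h6 : 0 ≤ h ^ 3 := by positivity
  have h7 : x / 2 - (x / 2) ^ 3 / 6 ≤ Real.sin (x / 2) := by
    rcases hx0.eq_or_lt with h0 | h0
    · rw [← h0]; simp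
    · exact (Real.sin_gt_sub_cube (by linarith)).le
  nlinarith

lemma volume_circlePt_preimage_le_of_dist_le {A : Set Plane} (hA : MeasurableSet A) {h : ℝ}
    (hh : h ≤ 1) (hd : ∀ x ∈ A, ∀ y ∈ A, dist x y ≤ h) (φ : ℝ) :
    volume (circlePt ⁻¹' A ∩ Ioc φ (φ + 2 * π)) ≤ ENNReal.ofReal (h + h ^ 3) := by
  rcases (circlePt ⁻¹' A).eq_empty_or_nonempty with he | ⟨θ, hθ⟩
  · simp [he]
  rw [volume_circlePt_preimage_inter_Ioc hA φ (θ - π)]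
  have key : ∀ x ∈ circlePt ⁻¹' A, ∀ y ∈ circlePt ⁻¹' A, |x - y| ≤ π →
      |x - y| ≤ h + h ^ 3 := by
    intro x hx y hy hxy
    refine abs_le_add_cube hxy ?_
    rw [← norm_circlePt_sub, ← dist_eq_norm]
    exact hd _ hx _ hy
  have hh0 : 0 ≤ h := by simpa using hd _ hθ _ hθ
  have hsin : ∀ x ∈ circlePt ⁻¹' A ∩ Ioc (θ - π) (θ - π + 2 * π), |x - θ| ≤ π / 2 * h := by
    rintro x ⟨hx, hx1, hx2⟩
    have hxπ : |x - θ| ≤ π := abs_le.2 ⟨by linarith, by linarith⟩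
    have h1 := hd _ hx _ hθ
    rw [dist_eq_norm, norm_circlePt_sub, Real.abs_sin_eq_sin_abs_of_abs_le_pi
      (by rw [abs_div, abs_two]; linarith [Real.pi_pos]), abs_div, abs_two] at h1
    have hj := Real.mul_le_sin (x := |x - θ| / 2) (by positivity) (by linarith)
    have h2 : 2 / π * (|x - θ| / 2) = |x - θ| / π := by ring
    rw [h2] at hj
    have : |x - θ| / π ≤ h / 2 := by linarith
    rw [div_le_iff₀ Real.pi_pos] at this
    linarith
  refine (Real.volume_le_diam _).trans (Metric.ediam_le fun x hx y hy => ?_)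
  rw [edist_dist, Real.dist_eq]
  refine ENNReal.ofReal_le_ofReal (key x hx.1 y hy.1 ?_)
  have h1 := hsin x hx
  have h2 := hsin y hy
  have h3 := abs_sub_le x θ y
  rw [abs_sub_comm θ y] at h3
  nlinarith [Real.pi_pos]

/-- A unit-speed trajectory visits arc measure at most `b - a` during `[a, b]`. -/
lemma volume_circlePt_preimage_image_Icc_le {f : ℝ → Plane} {a b : ℝ} (hab : a ≤ b)
    (hf : LipschitzOnWith 1 f (Icc a b)) (φ : ℝ) :
    volume (circlePt ⁻¹' (f '' Icc a b) ∩ Ioc φ (φ + 2 * π)) ≤ ENNReal.ofReal (b - a) := by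
  have bound : ∀ n : ℕ, b - a ≤ n + 1 →
      volume (circlePt ⁻¹' (f '' Icc a b) ∩ Ioc φ (φ + 2 * π)) ≤
        ENNReal.ofReal (b - a + (b - a) ^ 3 / (n + 1) ^ 2) := by
    intro n hn
    have hn0 : (0 : ℝ) < n + 1 := by positivity
    set h := (b - a) / (n + 1) with hh
    have hh0 : 0 ≤ h := div_nonneg (by linarith) hn0.le
    have hh1 : h ≤ 1 := (div_le_one hn0).2 hn
    have hnh : (n + 1) * h = b - a := by rw [hh]; field_simp
    have hsub : ∀ k ∈ Finset.range (n + 1), Icc (a + k * h) (a + (k + 1) * h) ⊆ Icc a b := by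
      intro k hk
      have hk' : (k : ℝ) + 1 ≤ n + 1 := by
        have := Finset.mem_range.1 hk
        exact_mod_cast this
      refine Icc_subset_Icc ?_ ?_
      · have : 0 ≤ (k : ℝ) * h := by positivity
        linarith
      · nlinarith
    have hcov : circlePt ⁻¹' (f '' Icc a b) ∩ Ioc φ (φ + 2 * π) ⊆
        ⋃ k ∈ Finset.range (n + 1),
          circlePt ⁻¹' (f '' Icc (a + k * h) (a + (k + 1) * h)) ∩ Ioc φ (φ + 2 * π) := by
      rintro θ ⟨⟨s, hs, hsθ⟩, hθ⟩
      simp only [mem_iUnion]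
      have : ∃ k ∈ Finset.range (n + 1), s ∈ Icc (a + k * h) (a + (k + 1) * h) := by
        rcases hh0.eq_or_lt with h0 | h0
        · refine ⟨0, by simp, ?_⟩
          rw [← h0] at hnh ⊢
          simp only [mul_zero, add_zero]
          exact ⟨hs.1, by linarith [hs.2]⟩
        · rcases hs.2.eq_or_lt with hb | hb
          · refine ⟨n, by simp, ?_⟩
            rw [hb, hnh]
            exact ⟨by nlinarith, by linarith⟩
          · have hq : 0 ≤ (s - a) / h := div_nonneg (by linarith [hs.1]) h0.le
            refine ⟨⌊(s - a) / h⌋₊, ?_, ?_, ?_⟩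
            · rw [Finset.mem_range, Nat.floor_lt hq, div_lt_iff₀ h0]
              push_cast
              linarith
            · have := Nat.floor_le hq
              rw [le_div_iff₀ h0] at this
              linarith
            · have := (Nat.lt_floor_add_one ((s - a) / h)).le
              rw [div_le_iff₀ h0] at this
              linarith
      obtain ⟨k, hk, hsk⟩ := this
      exact ⟨k, hk, ⟨s, hsk, hsθ⟩, hθ⟩
    calc _ ≤ _ := measure_mono hcov
      _ ≤ _ := measure_biUnion_finset_le _ _
      _ ≤ ∑ k ∈ Finset.range (n + 1), ENNReal.ofReal (h + h ^ 3) := by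
          refine Finset.sum_le_sum fun k hk => ?_
          have hfk := hf.mono (hsub k hk)
          refine volume_circlePt_preimage_le_of_dist_le
            (isCompact_Icc.image_of_continuousOn hfk.continuousOn).measurableSet hh1 ?_ φ
          rintro _ ⟨s, hs, rfl⟩ _ ⟨t, ht, rfl⟩
          have := hfk.dist_le_mul s hs t ht
          rw [NNReal.coe_one, one_mul, Real.dist_eq] at this
          refine this.trans (abs_le.2 ⟨?_, ?_⟩) <;> linarith [hs.1, hs.2, ht.1, ht.2]
      _ = _ := by
          rw [Finset.sum_const, Finset.card_range, nsmul_eq_mul, ← ENNReal.ofReal_natCast,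
            ← ENNReal.ofReal_mul (by positivity)]
          congr 1
          rw [hh]
          push_cast
          field_simp
  refine ge_of_tendsto (f := fun n : ℕ =>
    ENNReal.ofReal (b - a + (b - a) ^ 3 / ((n : ℝ) + 1) ^ 2)) (x := Filter.atTop) ?_ ?_
  · refine (ENNReal.continuous_ofReal.tendsto _).comp ?_
    have h1 := tendsto_one_div_add_atTop_nhds_zero_nat (𝕜 := ℝ)
    have h2 := ((h1.pow 2).const_mul ((b - a) ^ 3)).const_add (b - a)
    simp only [ne_eq, OfNat.ofNat_ne_zero, not_false_eq_true, zero_pow, mul_zero, add_zero] at h2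
    refine h2.congr fun n => ?_
    rw [one_div, inv_pow, div_eq_mul_inv]
  · obtain ⟨m, hm⟩ := exists_nat_ge (b - a)
    filter_upwards [Filter.eventually_ge_atTop m] with n hn
    refine bound n ?_
    have : (m : ℝ) ≤ n := by exact_mod_cast hn
    linarith

lemma IsTraj.norm_sub_le {f : ℝ → Plane} (hf : IsTraj f) {s t : ℝ} (hs : 0 ≤ s) (ht : 0 ≤ t) :
    ‖f s - f t‖ ≤ |s - t| := by
  have := hf.1.dist_le_mul s hs t ht
  rwa [NNReal.coe_one, one_mul, Real.dist_eq, dist_eq_norm] at this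

lemma IsTraj.one_le {f : ℝ → Plane} (hf : IsTraj f) {s : ℝ} (hs : 0 ≤ s) (h : ‖f s‖ = 1) :
    1 ≤ s := by
  have := hf.norm_sub_le hs le_rfl
  rwa [hf.2, sub_zero, sub_zero, h, abs_of_nonneg hs] at this

section Visit

variable {n : ℕ} {Q : ℝ → Plane} {S : Fin n → ℝ → Plane} {B : ℝ}

lemma visited_at_visitTime (hQ : IsTraj Q) (hS : ∀ i, IsTraj (S i)) {p : Plane}
    (hp : ∃ t : ℝ, 0 ≤ t ∧ (Q t = p ∨ ∃ i, S i t = p)) :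
    0 ≤ visitTime Q S p ∧ (Q (visitTime Q S p) = p ∨ ∃ i, S i (visitTime Q S p) = p) := by
  have closed : ∀ f, IsTraj f → IsClosed (Ici 0 ∩ f ⁻¹' {p}) := fun f hf =>
    hf.1.continuousOn.preimage_isClosed_of_isClosed isClosed_Ici isClosed_singleton
  have hc : IsClosed {t : ℝ | 0 ≤ t ∧ (Q t = p ∨ ∃ i, S i t = p)} := by
    have : {t : ℝ | 0 ≤ t ∧ (Q t = p ∨ ∃ i, S i t = p)} =
        (Ici 0 ∩ Q ⁻¹' {p}) ∪ ⋃ i, (Ici 0 ∩ S i ⁻¹' {p}) := by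
      ext t; simp only [mem_ofPred_eq, mem_union, mem_iUnion, mem_inter_iff, mem_Ici,
        mem_preimage, mem_singleton_iff, exists_and_left]
      tauto
    rw [this]
    exact (closed Q hQ).union (isClosed_iUnion_of_finite fun i => closed _ (hS i))
  exact hc.csInf_mem hp ⟨0, fun t ht => ht.1⟩

/-- A point at distance more than `B - t` from the queen at time `t` has been visited by then. -/
lemma visitTime_le_of_lt (hQ : IsTraj Q) (hS : ∀ i, IsTraj (S i)) (hEv : Evacuates Q S B)
    {p : Plane} (hp : ‖p‖ = 1) {t : ℝ} (ht : 0 ≤ t) (hd : B - t < ‖Q t - p‖) :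
    visitTime Q S p ≤ t := by
  by_contra! h
  obtain ⟨h1, h2⟩ := hEv p hp
  have h3 := hQ.norm_sub_le ht (visited_at_visitTime hQ hS h1).1
  rw [abs_sub_comm, abs_of_pos (by linarith)] at h3
  have h4 := norm_sub_le_norm_sub_add_norm_sub (Q t) (Q (visitTime Q S p)) p
  linarith

lemma visitTime_le (hEv : Evacuates Q S B) {p : Plane} (hp : ‖p‖ = 1) : visitTime Q S p ≤ B := by
  linarith [(hEv p hp).2, norm_nonneg (Q (visitTime Q S p) - p)]

lemma exists_visit (hQ : IsTraj Q) (hS : ∀ i, IsTraj (S i)) (hEv : Evacuates Q S B)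
    {p : Plane} (hp : ‖p‖ = 1) {t : ℝ} (ht : visitTime Q S p ≤ t) :
    p ∈ Q '' Icc 1 t ∨ ∃ i, p ∈ S i '' Icc 1 t := by
  obtain ⟨h0, h⟩ := visited_at_visitTime hQ hS (hEv p hp).1
  rcases h with h | ⟨i, h⟩
  · exact Or.inl ⟨_, ⟨hQ.one_le h0 (by rw [h, hp]), ht⟩, h⟩
  · exact Or.inr ⟨i, _, ⟨(hS i).one_le h0 (by rw [h, hp]), ht⟩, h⟩

end Visit

/-- The points at distance more than `d` from a point of the circle form an arc of length
`4 * arccos (d / 2)`. -/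
lemma lt_norm_circlePt_sub {φ d θ : ℝ} (hd0 : 0 ≤ d) (hd2 : d ≤ 2)
    (hθ : θ ∈ Ioo (φ + π - 2 * arccos (d / 2)) (φ + π + 2 * arccos (d / 2))) :
    d < ‖circlePt φ - circlePt θ‖ := by
  rw [norm_circlePt_sub]
  have h1 := Real.arccos_le_pi_div_two.2 (show 0 ≤ d / 2 by linarith)
  have h2 := Real.cos_arccos (x := d / 2) (by linarith) (by linarith)
  have e : Real.sin ((φ - θ) / 2) = - Real.cos ((θ - φ - π) / 2) := by
    rw [show (φ - θ) / 2 = -((θ - φ - π) / 2 + π / 2) by ring, Real.sin_neg,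
      Real.sin_add_pi_div_two]
  have h3 : Real.cos (arccos (d / 2)) < Real.cos |(θ - φ - π) / 2| := by
    refine Real.cos_lt_cos_of_nonneg_of_le_pi_div_two (abs_nonneg _) h1 (abs_lt.2 ⟨?_, ?_⟩)
      <;> linarith [hθ.1, hθ.2]
  rw [h2, Real.cos_abs] at h3
  rw [e, abs_neg]
  linarith [le_abs_self (Real.cos ((θ - φ - π) / 2))]

/-- An angular set covered by two servants during `[1, t]` and the queen during `[1, u]`. -/
lemma volume_le_of_covered {Q : ℝ → Plane} {S : Fin 2 → ℝ → Plane} (hQ : IsTraj Q)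
    (hS : ∀ i, IsTraj (S i)) {t u φ : ℝ} (ht : 1 ≤ t) (hu : 1 ≤ u) {G : Set ℝ}
    (hG : G ⊆ Ioc φ (φ + 2 * π))
    (hcov : ∀ θ ∈ G, (circlePt θ ∈ Q '' Icc 1 u ∨ circlePt θ = Q t) ∨
      ∃ i, circlePt θ ∈ S i '' Icc 1 t) :
    volume G ≤ ENNReal.ofReal (2 * (t - 1) + (u - 1)) := by
  have bound : ∀ f, IsTraj f → ∀ a b : ℝ, 0 ≤ a → a ≤ b →
      volume (circlePt ⁻¹' (f '' Icc a b) ∩ Ioc φ (φ + 2 * π)) ≤ ENNReal.ofReal (b - a) :=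
    fun f hf a b ha hab => volume_circlePt_preimage_image_Icc_le hab
      (hf.1.mono fun x hx => ha.trans hx.1) φ
  have hsub : G ⊆ ((circlePt ⁻¹' (S 0 '' Icc 1 t) ∩ Ioc φ (φ + 2 * π)) ∪
      (circlePt ⁻¹' (S 1 '' Icc 1 t) ∩ Ioc φ (φ + 2 * π))) ∪
      ((circlePt ⁻¹' (Q '' Icc 1 u) ∩ Ioc φ (φ + 2 * π)) ∪
      (circlePt ⁻¹' (Q '' Icc t t) ∩ Ioc φ (φ + 2 * π))) := by
    intro θ hθ
    have hI := hG hθ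
    rcases hcov θ hθ with (h | h) | ⟨i, h⟩
    · exact Or.inr (Or.inl ⟨h, hI⟩)
    · exact Or.inr (Or.inr ⟨⟨t, ⟨le_rfl, le_rfl⟩, h.symm⟩, hI⟩)
    · fin_cases i
      · exact Or.inl (Or.inl ⟨h, hI⟩)
      · exact Or.inl (Or.inr ⟨h, hI⟩)
  have b0 := bound _ (hS 0) 1 t zero_le_one ht
  have b1 := bound _ (hS 1) 1 t zero_le_one ht
  have b2 := bound _ hQ 1 u zero_le_one hu
  have b3 := bound _ hQ t t (by linarith) le_rfl
  refine (measure_mono hsub).trans ?_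
  refine ((measure_union_le _ _).trans (add_le_add ((measure_union_le _ _).trans
    (add_le_add b0 b1)) ((measure_union_le _ _).trans (add_le_add b2 b3)))).trans_eq ?_
  rw [← ENNReal.ofReal_add (by linarith) (by linarith), ← ENNReal.ofReal_add (by linarith)
    (by linarith), ← ENNReal.ofReal_add (by linarith) (by linarith)]
  congr 1
  ring

/-- If the queen is on the circle at time `t`, all points at distance more than `d` from her
having been visited gives a bound on the corresponding arc. -/
lemma four_mul_arccos_le {Q : ℝ → Plane} {S : Fin 2 → ℝ → Plane} (hQ : IsTraj Q)
    (hS : ∀ i, IsTraj (S i)) {t u d : ℝ} (ht : 1 ≤ t) (hu : 1 ≤ u) (hd0 : 0 ≤ d) (hd2 : d ≤ 2)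
    (hQt : ‖Q t‖ = 1)
    (hcov : ∀ p : Plane, ‖p‖ = 1 → d < ‖Q t - p‖ → (p ∈ Q '' Icc 1 u ∨ p = Q t) ∨
      ∃ i, p ∈ S i '' Icc 1 t) :
    4 * arccos (d / 2) ≤ 2 * (t - 1) + (u - 1) := by
  obtain ⟨φ, hφ⟩ := exists_circlePt_eq hQt
  have h1 := Real.arccos_le_pi_div_two.2 (show 0 ≤ d / 2 by linarith)
  have := volume_le_of_covered hQ hS (φ := φ) ht hu
    (G := Ioo (φ + π - 2 * arccos (d / 2)) (φ + π + 2 * arccos (d / 2)))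
    (fun x hx => ⟨by linarith [hx.1], by linarith [hx.2]⟩)
    (fun θ hθ => hcov _ (norm_circlePt θ) (by rw [← hφ]; exact lt_norm_circlePt_sub hd0 hd2 hθ))
  rw [Real.volume_Ioo, ENNReal.ofReal_le_ofReal_iff (by linarith)] at this
  linarith

lemma cos_sub_cos_lt {x y : ℝ} (h : x < y) : Real.cos x - Real.cos y < y - x := by
  rw [Real.cos_sub_cos, show (x - y) / 2 = -((y - x) / 2) by ring, Real.sin_neg]
  have h1 := Real.abs_sin_lt_abs (x := (y - x) / 2) (by linarith)
  rw [abs_of_pos (by linarith : 0 < (y - x) / 2)] at h1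
  have h2 := le_abs_self (Real.sin ((x + y) / 2) * Real.sin ((y - x) / 2))
  rw [abs_mul] at h2
  have h3 := mul_le_of_le_one_left (abs_nonneg (Real.sin ((y - x) / 2)))
    (Real.abs_sin_le_one ((x + y) / 2))
  linarith

lemma cos_le_quartic {x : ℝ} (h0 : 0 ≤ x) (h1 : x ≤ 1) :
    Real.cos x ≤ 1 - x ^ 2 / 2 + x ^ 4 * (5 / 96) := by
  have h := (abs_le.1 (Real.cos_bound (x := x) (abs_le.2 ⟨by linarith, h1⟩))).2
  rw [abs_of_nonneg h0] at h
  linarith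

lemma three_mul_add_four_mul_cos_lt {a m : ℝ} (ha0 : 0 < a) (ha1 : a < 1) (hm : m < 2)
    (h1 : 2 * m = a + 2 * Real.cos (a / 2)) (h2 : m = 2 * Real.cos ((2 * m + a) / 4)) :
    3 * a + 4 * Real.cos (a / 2) < 2 * π := by
  have ha : a < 0.85 := by
    by_contra! h
    have h3 := Real.one_sub_sq_div_two_le_cos (x := a / 2)
    have hm1 : 1.3346 ≤ m := by nlinarith
    have h4 : Real.cos ((2 * m + a) / 4) ≤ Real.cos 0.8798 :=
      Real.cos_le_cos_of_nonneg_of_le_pi (by norm_num) (by linarith [Real.pi_gt_three])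
        (by linarith)
    have h5 := cos_le_quartic (x := 0.8798) (by norm_num) (by norm_num)
    norm_num at h5
    linarith
  have h3 := cos_le_quartic (x := a / 2) (by linarith) (by linarith)
  have := Real.pi_gt_d2
  have : a ^ 4 ≤ a ^ 2 := pow_le_pow_of_le_one ha0.le ha1.le (by norm_num)
  nlinarith

/-- with two servants and evacuation time `B < T₂`, the queen can explore
arc measure at most `τ - 1`, where `τ, t*, T₂` solve the stated system. -/
theorem queen_exploration_upper_bound_two_servants
    (τ tstar T₂ : ℝ)
    (hτ : 1 < τ) (hτ' : τ < 2) (hts : 2 < tstar) (hts' : tstar < 3)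
    (hT : 3 < T₂) (hT' : T₂ < 4)
    (e1 : τ = T₂ - 2 * Real.cos ((τ - 1) / 2))
    (e2 : tstar = (T₂ + 1) / 2)
    (e3 : T₂ = tstar + 2 * Real.cos ((2 * tstar + τ) / 4 - 3 / 4))
    (Q : ℝ → Plane) (S : Fin 2 → ℝ → Plane)
    (hQ : IsTraj Q) (hS : ∀ i, IsTraj (S i))
    (B : ℝ) (hB : B < T₂) (hEv : Evacuates Q S B) :
    volume (queenArc Q (Set.Ici 0)) ≤ ENNReal.ofReal (τ - 1) := by
  exfalso
  have hπ := Real.pi_gt_three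
  have early : ∀ t, τ < t → t ≤ tstar → ‖Q t‖ ≠ 1 := by
    intro t h1 h2 hQt
    have h3 := Real.cos_le_one ((τ - 1) / 2)
    have h4 := four_mul_arccos_le hQ hS (t := t) (u := 1) (d := T₂ - t) (by linarith) le_rfl
      (by linarith) (by linarith) hQt fun p hp hd => by
        rcases exists_visit hQ hS hEv hp
          (visitTime_le_of_lt (t := t) hQ hS hEv hp (by linarith) (by linarith)) with ⟨s, hs, rfl⟩ | h
        · have := hQ.norm_sub_le (s := t) (t := s) (by linarith) (by linarith [hs.1])
          rw [abs_of_nonneg (by linarith [hs.2])] at this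
          linarith [hs.1]
        · exact Or.inr h
    have h5 := cos_sub_cos_lt (show (τ - 1) / 2 < (t - 1) / 2 by linarith)
    have h6 : arccos (Real.cos ((t - 1) / 2)) < arccos ((T₂ - t) / 2) :=
      Real.arccos_lt_arccos (by linarith) (by linarith) (Real.cos_le_one _)
    rw [Real.arccos_cos (by linarith) (by linarith)] at h6
    linarith
  have queen_image : ∀ t, (∀ s, tstar ≤ s → s ≤ t → ‖Q s‖ ≠ 1) → ∀ p ∈ Q '' Icc 1 t,
      ‖p‖ = 1 → p ∈ Q '' Icc 1 τ := by
    rintro t ht _ ⟨s, hs, rfl⟩ hp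
    refine ⟨s, ⟨hs.1, ?_⟩, rfl⟩
    by_contra! h
    rcases le_total s tstar with h' | h'
    · exact early s h h' hp
    · exact ht s h' hs.2 hp
  have late : ∀ t, tstar ≤ t → t ≤ B → ‖Q t‖ ≠ 1 := by
    by_contra! h
    obtain ⟨r, hr1, hr2, hr⟩ := h
    have hK : IsCompact (Icc tstar B ∩ (fun s => ‖Q s‖) ⁻¹' {1}) := by
      refine isCompact_Icc.of_isClosed_subset (ContinuousOn.preimage_isClosed_of_isClosed
        ?_ isClosed_Icc isClosed_singleton) inter_subset_left
      exact (hQ.1.continuousOn.mono fun x hx => (by linarith [hx.1] : (0:ℝ) ≤ x)).norm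
    obtain ⟨t, ⟨⟨ht1, ht2⟩, hQt⟩, hmin⟩ := hK.exists_isLeast ⟨r, ⟨hr1, hr2⟩, hr⟩
    have h4 := four_mul_arccos_le hQ hS (t := t) (u := τ) (d := B - t) (by linarith) hτ.le
      (by linarith) (by linarith) hQt fun p hp hd => by
        rcases exists_visit hQ hS hEv hp
          (visitTime_le_of_lt hQ hS hEv hp (by linarith) hd) with ⟨s, hs, rfl⟩ | h
        · rcases hs.2.eq_or_lt with rfl | hst
          · exact Or.inl (Or.inr rfl)
          · refine Or.inl (Or.inl (queen_image s (fun x hx1 hx2 hx => ?_) _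
              ⟨s, ⟨hs.1, le_rfl⟩, rfl⟩ hp))
            have := hmin ⟨⟨hx1, by linarith⟩, hx⟩
            linarith
        · exact Or.inr h
    have h5 : (B - t) / 2 < Real.cos ((2 * t + τ) / 4 - 3 / 4) := by
      rcases ht1.eq_or_lt with rfl | h
      · linarith
      · have := cos_sub_cos_lt
          (show (2 * tstar + τ) / 4 - 3 / 4 < (2 * t + τ) / 4 - 3 / 4 by linarith)
        linarith
    have h6 := Real.arccos_lt_arccos (by linarith) h5 (Real.cos_le_one _)
    rw [Real.arccos_cos (by linarith) (by linarith)] at h6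
    linarith
  have hB1 : 1 ≤ B := by
    have hp := norm_circlePt 0
    rcases exists_visit hQ hS hEv hp (visitTime_le hEv hp) with ⟨s, hs, -⟩ | ⟨i, s, hs, -⟩ <;>
    linarith [hs.1, hs.2]
  have total := volume_le_of_covered hQ hS (t := B) (u := τ) (φ := 0) hB1 hτ.le subset_rfl
    fun θ _ => by
      have hp := norm_circlePt θ
      rcases exists_visit hQ hS hEv hp (visitTime_le hEv hp) with h | h
      · exact Or.inl (Or.inl (queen_image B late _ h hp))
      · exact Or.inr h
  rw [Real.volume_Ioc, ENNReal.ofReal_le_ofReal_iff (by linarith)] at total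
  have := three_mul_add_four_mul_cos_lt (a := τ - 1) (m := tstar - 1) (by linarith) (by linarith)
    (by linarith) (by linarith) (by
      rw [show (2 * (tstar - 1) + (τ - 1)) / 4 = (2 * tstar + τ) / 4 - 3 / 4 by ring]
      linarith)
  linarith
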